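/- arXiv:2410.17447 — 2 statements merged into one kernel-verified Lean document; each statement's English description precedes it below -/
import Mathlib

section
/- Fix z > 1 and 0 ≤ i < m ≤ k. In the compound negative-binomial construction with parameter z, the random variable Σ_{j=1}^{T_m} N_{i,j}^{(m)} has the negative binomial distribution p^NB_{(1+δ)/b_i, z^{−b_i/b_0}}; equivalently, for all x ∈ [0,1], E[x^{Σ_{j=1}^{T_m} N_{i,j}^{(m)}}] = (x(1−z^{b_i/b_0}) + z^{b_i/b_0})^{−(1+δ)/b_i}. -/
open MeasureTheory Filter Finset

noncomputable section

/-- The coefficient `b_m = k - m + 1 + δ(k - m)`. -/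
def bcoef (k : ℕ) (δ : ℝ) (m : ℕ) : ℝ := (k : ℝ) - m + 1 + δ * ((k : ℝ) - m)

/-- The coefficient `τ = k + 2 + δ(k + 1)`. -/
def tauc (k : ℕ) (δ : ℝ) : ℝ := (k : ℝ) + 2 + δ * ((k : ℝ) + 1)

/-- The negative binomial pmf with shape `r` and success probability `a`. -/
def nbWeight (r a : ℝ) (ℓ : ℕ) : ℝ :=
  Real.Gamma ((ℓ : ℝ) + r) / ((ℓ.factorial : ℝ) * Real.Gamma r) * (1 - a) ^ ℓ * a ^ r

/-- The extended truncated negative binomial pmf with parameters `κ` and `a`. -/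
def tnbWeight (κ a : ℝ) (ℓ : ℕ) : ℝ :=
  if ℓ = 0 then 0
  else κ * Real.Gamma ((ℓ : ℝ) - κ) / ((ℓ.factorial : ℝ) * Real.Gamma (1 - κ))
    * (1 - a) ^ ℓ / (1 - a ^ κ)

/-- The measure on `ℕ` with mass function `f`. -/
def natMeasure (f : ℕ → ℝ) : Measure ℕ :=
  Measure.sum fun ℓ => ENNReal.ofReal (f ℓ) • Measure.dirac ℓ

/-- `ℓ`-fold convolution power of a measure on `Fin m → ℕ`, i.e. the law of a sum of `ℓ`
i.i.d. vectors of law `ν`. -/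
def convPow {m : ℕ} (ν : Measure (Fin m → ℕ)) : ℕ → Measure (Fin m → ℕ)
  | 0 => Measure.dirac 0
  | ℓ + 1 => (ν.prod (convPow ν ℓ)).map fun p => p.1 + p.2

/-- The law of the random vector `(N_0^{(m)}, …, N_{m-1}^{(m)})` from the compound
negative-binomial construction with parameter `z`: the last coordinate `N_{m-1}^{(m)}` is
extended truncated negative binomial with parameters `b_m / b_{m-1}` and `z^{-b_{m-1}/b_0}`,
and conditionally on `N_{m-1}^{(m)} = ℓ` the first `m - 1` coordinates form the sum of `ℓ`
i.i.d. copies of `(N_0^{(m-1)}, …, N_{m-2}^{(m-1)})`. -/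
def vecLaw (k : ℕ) (δ : ℝ) (z : ℝ) : (m : ℕ) → Measure (Fin m → ℕ)
  | 0 => Measure.dirac 0
  | m + 1 =>
    (natMeasure (tnbWeight (bcoef k δ (m + 1) / bcoef k δ m)
        (z ^ (-(bcoef k δ m / bcoef k δ 0))))).bind
      fun ℓ => (convPow (vecLaw k δ z m) ℓ).map fun v => Fin.snoc v ℓ

/-- The joint law of `(T_m, Σ_{j=1}^{T_m} (N_{0,j}^{(m)}, …, N_{m-1,j}^{(m)}))`, where
`T_m` is negative binomial with shape `(1+δ)/b_m` and success probability `z^{-b_m/b_0}`,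
and the summands are i.i.d. copies of `(N_0^{(m)}, …, N_{m-1}^{(m)})` independent of `T_m`. -/
def pairLaw (k : ℕ) (δ : ℝ) (z : ℝ) (m : ℕ) : Measure (ℕ × (Fin m → ℕ)) :=
  (natMeasure (nbWeight ((1 + δ) / bcoef k δ m) (z ^ (-(bcoef k δ m / bcoef k δ 0))))).bind
    fun t => (convPow (vecLaw k δ z m) t).map fun v => (t, v)

/-- The joint law of the independent family
`((T_m, Σ_{j=1}^{T_m} N_{·,j}^{(m)}))_{m = 0, …, k}` given `z`. -/
def jointLaw (k : ℕ) (δ : ℝ) (z : ℝ) :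
    Measure (∀ m : Fin (k + 1), ℕ × (Fin (m : ℕ) → ℕ)) :=
  Measure.pi fun m => pairLaw k δ z (m : ℕ)

/-- Assembles the degree vector: coordinate `i` is
`k - i + 1 + T_i + Σ_{m=i+1}^{k} Σ_{j=1}^{T_m} N_{i,j}^{(m)}`. -/
def assembleD (k : ℕ) (x : ∀ m : Fin (k + 1), ℕ × (Fin (m : ℕ) → ℕ)) : Fin (k + 1) → ℕ :=
  fun i => (k - (i : ℕ) + 1) + (x i).1 +
    ∑ m : Fin (k + 1), if h : (i : ℕ) < (m : ℕ) then (x m).2 ⟨(i : ℕ), h⟩ else 0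

/-- Given `z`, the conditional law of the random degree vector
`(k - i + 1 + T_i + Σ_{m=i+1}^{k} Σ_{j=1}^{T_m} N_{i,j}^{(m)})_{i = 0, …, k}`. -/
def Dlaw (k : ℕ) (δ : ℝ) (z : ℝ) : Measure (Fin (k + 1) → ℕ) :=
  (jointLaw k δ z).map (assembleD k)

/-- Away from the poles, the coefficients of `(1 - y) ^ (-s)` are quotients of Gamma values. -/
lemma choose_add_sub_one_eq_gamma {s : ℝ} (hs : ∀ j : ℕ, s ≠ -j) (n : ℕ) :
    Ring.choose (s + n - 1) n = Real.Gamma (n + s) / (n.factorial * Real.Gamma s) := by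
  have hΓ : Real.Gamma s ≠ 0 := Real.Gamma_ne_zero hs
  have key : ∀ n : ℕ, Real.Gamma (n + s) = (ascPochhammer ℝ n).eval s * Real.Gamma s := by
    intro n
    induction n with
    | zero => simp
    | succ n ih =>
      have h : (n : ℝ) + s ≠ 0 := fun h => hs n (by linarith)
      rw [ascPochhammer_succ_eval, Nat.cast_succ, add_right_comm, Real.Gamma_add_one h, ih]
      ring
  have h := Ring.factorial_nsmul_multichoose_eq_ascPochhammer s n
  rw [Ring.multichoose_eq, Polynomial.ascPochhammer_smeval_eq_eval, nsmul_eq_mul] at h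
  rw [key, ← h]
  field_simp

lemma hasSum_gamma_one_sub_rpow {s y : ℝ} (hs : ∀ j : ℕ, s ≠ -j) (hy : |y| < 1) :
    HasSum (fun n : ℕ => Real.Gamma (n + s) / (n.factorial * Real.Gamma s) * y ^ n)
      ((1 - y) ^ (-s)) := by
  have h := (Real.one_div_one_sub_rpow_hasFPowerSeriesOnBall_zero s).hasSum (y := y) (by
    simpa [enorm_eq_nnnorm, ← NNReal.coe_lt_one] using hy)
  have h1 : 0 ≤ 1 - y := by linarith [(abs_lt.mp hy).2]
  rw [Real.rpow_neg h1, ← one_div]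
  simpa [FormalMultilinearSeries.ofScalars_apply_eq, choose_add_sub_one_eq_gamma hs,
    mul_comm (y ^ _)] using h

lemma hasSum_nbWeight {r a g : ℝ} (hr : 0 < r) (hy : |(1 - a) * g| < 1) :
    HasSum (fun l => nbWeight r a l * g ^ l) (a ^ r * (1 - (1 - a) * g) ^ (-r)) := by
  have hs : ∀ j : ℕ, r ≠ -j := fun j h => by
    have : (0 : ℝ) ≤ j := j.cast_nonneg
    linarith
  refine ((hasSum_gamma_one_sub_rpow hs hy).mul_left (a ^ r)).congr_fun fun l => ?_
  rw [nbWeight, mul_pow]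
  ring

lemma hasSum_tnbWeight {κ a g : ℝ} (hκ : 0 < κ) (hκ' : κ < 1) (hy : |(1 - a) * g| < 1) :
    HasSum (fun l => tnbWeight κ a l * g ^ l) ((1 - (1 - (1 - a) * g) ^ κ) / (1 - a ^ κ)) := by
  have hs : ∀ j : ℕ, -κ ≠ -j := by
    rintro (_ | j) h
    · simp at h
      linarith
    · have : (0 : ℝ) ≤ j := j.cast_nonneg
      push_cast at h
      linarith
  have hΓ : Real.Gamma (-κ) ≠ 0 := Real.Gamma_ne_zero hs
  have hΓ' : Real.Gamma (1 - κ) = -κ * Real.Gamma (-κ) := by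
    rw [← Real.Gamma_add_one (neg_ne_zero.mpr hκ.ne')]
    ring_nf
  have h := (hasSum_gamma_one_sub_rpow hs hy).update 0 0
  rw [neg_neg] at h
  have h' := (h.mul_left (-1)).div_const (1 - a ^ κ)
  have hS : -1 * (0 - Real.Gamma ((0 : ℕ) + -κ) / ((Nat.factorial 0 : ℕ) * Real.Gamma (-κ))
      * ((1 - a) * g) ^ 0 + (1 - (1 - a) * g) ^ κ) / (1 - a ^ κ)
      = (1 - (1 - (1 - a) * g) ^ κ) / (1 - a ^ κ) := by
    simp [hΓ]
    ring
  rw [hS] at h'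
  refine h'.congr_fun fun l => ?_
  rcases eq_or_ne l 0 with rfl | hl
  · simp [tnbWeight]
  · simp only [tnbWeight, hl, if_false, ne_eq, not_false_eq_true, Function.update_of_ne]
    rw [hΓ', mul_pow, sub_eq_add_neg (l : ℝ) κ]
    field_simp

lemma nbWeight_nonneg {r a : ℝ} (hr : 0 < r) (ha : 0 ≤ a) (ha' : a ≤ 1) (l : ℕ) :
    0 ≤ nbWeight r a l := by
  have h1 := Real.Gamma_pos_of_pos hr
  have h2 : 0 < Real.Gamma (l + r) := Real.Gamma_pos_of_pos (by positivity)
  have h3 : 0 ≤ 1 - a := by linarith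
  unfold nbWeight
  positivity

lemma tnbWeight_nonneg {κ a : ℝ} (hκ : 0 < κ) (hκ' : κ < 1) (ha : 0 ≤ a) (ha' : a ≤ 1) (l : ℕ) :
    0 ≤ tnbWeight κ a l := by
  unfold tnbWeight
  split_ifs with hl
  · rfl
  · have hl' : (1 : ℝ) ≤ l := by exact_mod_cast Nat.one_le_iff_ne_zero.mpr hl
    have h1 : 0 < Real.Gamma (1 - κ) := Real.Gamma_pos_of_pos (by linarith)
    have h2 : 0 < Real.Gamma (l - κ) := Real.Gamma_pos_of_pos (by linarith)
    have h3 : 0 ≤ 1 - a := by linarith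
    have h4 : 0 ≤ 1 - a ^ κ := by linarith [Real.rpow_le_one ha ha' hκ.le]
    positivity

lemma lintegral_pow_natMeasure {f : ℕ → ℝ} {g S : ℝ} (hf : ∀ l, 0 ≤ f l) (hg : 0 ≤ g)
    (h : HasSum (fun l => f l * g ^ l) S) :
    ∫⁻ l, ENNReal.ofReal g ^ l ∂natMeasure f = ENNReal.ofReal S := by
  have h0 : ∀ l, 0 ≤ f l * g ^ l := fun l => mul_nonneg (hf l) (pow_nonneg hg l)
  rw [natMeasure, lintegral_sum_measure, ← h.tsum_eq, ENNReal.ofReal_tsum_of_nonneg h0 h.summable]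
  refine tsum_congr fun l => ?_
  rw [lintegral_smul_measure, lintegral_dirac, smul_eq_mul, ENNReal.ofReal_mul (hf l),
    ENNReal.ofReal_pow hg]

lemma sfinite_of_countable {α : Type*} [MeasurableSpace α] [Countable α]
    [MeasurableSingletonClass α] (μ : Measure α) : SFinite μ := by
  rw [← Measure.sum_smul_dirac μ]
  infer_instance

lemma lintegral_pow_convPow {m : ℕ} (ν : Measure (Fin m → ℕ)) (c : ENNReal) (i : Fin m) (l : ℕ) :
    ∫⁻ v, c ^ v i ∂convPow ν l = (∫⁻ v, c ^ v i ∂ν) ^ l := by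
  induction l with
  | zero => simp [convPow]
  | succ l ih =>
    have := sfinite_of_countable (convPow ν l)
    rw [convPow, lintegral_map (measurable_of_countable _) (measurable_of_countable _)]
    simp only [Pi.add_apply, pow_add c]
    rw [lintegral_prod_mul (f := fun v : Fin m → ℕ => c ^ v i) (g := fun v : Fin m → ℕ => c ^ v i)
      (measurable_of_countable _).aemeasurable (measurable_of_countable _).aemeasurable, ih, pow_succ']

/-- A power series with bounded coefficients is determined by its sum on `(0, 1)`. -/
lemma eq_of_tsum_pow_eq {p q : ℕ → ℝ} {C : ℝ} (hp : ∀ n, |p n| ≤ C) (hq : ∀ n, |q n| ≤ C)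
    (h : ∀ x ∈ Set.Ioo (0 : ℝ) 1, ∑' n, p n * x ^ n = ∑' n, q n * x ^ n) : p = q := by
  have key : ∀ p : ℕ → ℝ, (∀ n, |p n| ≤ C) → HasFPowerSeriesAt (fun x => ∑' n, p n * x ^ n)
      (FormalMultilinearSeries.ofScalars ℝ p) 0 := by
    intro p hp
    have hr : (1 : ENNReal) ≤ (FormalMultilinearSeries.ofScalars ℝ p).radius := by
      have := (FormalMultilinearSeries.ofScalars ℝ p).le_radius_of_bound (r := 1) C fun n => by
        simpa using hp n
      simpa using this
    have h := ((FormalMultilinearSeries.ofScalars ℝ p).hasFPowerSeriesOnBall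
      (zero_lt_one.trans_le hr)).hasFPowerSeriesAt
    convert! h using 1
    ext x
    simp [FormalMultilinearSeries.sum, mul_comm]
  have hP := key p hp
  have hQ := key q hq
  have hev : ∃ᶠ x in nhdsWithin (0 : ℝ) {0}ᶜ, ∑' n, p n * x ^ n = ∑' n, q n * x ^ n := by
    have h1 : ∀ᶠ x in nhdsWithin (0 : ℝ) (Set.Ioi 0), ∑' n, p n * x ^ n = ∑' n, q n * x ^ n := by
      filter_upwards [Ioo_mem_nhdsGT (zero_lt_one' ℝ)] with x hx using h x hx
    exact h1.frequently.filter_mono (nhdsWithin_mono _ fun x hx => (ne_of_gt hx))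
  have heq := (hP.analyticAt.frequently_eq_iff_eventually_eq hQ.analyticAt).1 hev
  have := hP.eq_formalMultilinearSeries_of_eventually hQ heq
  ext n
  simpa using congrArg (fun s => s.coeff n) this

lemma measure_nat_ext_of_lintegral_pow {μ ν : Measure ℕ} [IsProbabilityMeasure μ]
    [IsProbabilityMeasure ν] (h : ∀ x ∈ Set.Ioo (0 : ℝ) 1,
      ∫⁻ n, ENNReal.ofReal x ^ n ∂μ = ∫⁻ n, ENNReal.ofReal x ^ n ∂ν) : μ = ν := by
  have key : ∀ μ : Measure ℕ, IsProbabilityMeasure μ → ∀ x ∈ Set.Ioo (0 : ℝ) 1,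
      ∑' n, μ.real {n} * x ^ n = (∫⁻ n, ENNReal.ofReal x ^ n ∂μ).toReal := by
    intro μ hμ x hx
    rw [lintegral_countable', ENNReal.tsum_toReal_eq]
    · refine tsum_congr fun n => ?_
      rw [ENNReal.toReal_mul, ENNReal.toReal_pow, ENNReal.toReal_ofReal hx.1.le, mul_comm]
      rfl
    · intro n
      exact ENNReal.mul_ne_top (ENNReal.pow_ne_top ENNReal.ofReal_ne_top) (measure_ne_top _ _)
  have hb : ∀ μ : Measure ℕ, IsProbabilityMeasure μ → ∀ n : ℕ, |μ.real {n}| ≤ 1 := fun μ _ n => by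
    rw [abs_of_nonneg measureReal_nonneg]
    exact measureReal_le_one
  have := eq_of_tsum_pow_eq (hb μ inferInstance) (hb ν inferInstance) fun x hx => by
    rw [key μ inferInstance x hx, key ν inferInstance x hx, h x hx]
  refine Measure.ext_of_singleton fun n => ?_
  rw [← ofReal_measureReal, ← ofReal_measureReal]
  exact congrArg ENNReal.ofReal (congrFun this n)

lemma bcoef_pos {k m : ℕ} {δ : ℝ} (hδ : -1 < δ) (hm : m ≤ k) : 0 < bcoef k δ m := by
  have : (m : ℝ) ≤ k := by exact_mod_cast hm
  unfold bcoef
  nlinarith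

lemma bcoef_succ_lt {k m : ℕ} {δ : ℝ} (hδ : -1 < δ) : bcoef k δ (m + 1) < bcoef k δ m := by
  unfold bcoef
  push_cast
  linarith

lemma rpow_neg_bcoef_rpow {k i m : ℕ} {δ z : ℝ} (hδ : -1 < δ) (hz : 1 < z) (hi : i ≤ k) :
    (z ^ (-(bcoef k δ i / bcoef k δ 0))) ^ (bcoef k δ m / bcoef k δ i)
      = z ^ (-(bcoef k δ m / bcoef k δ 0)) := by
  have hi := bcoef_pos hδ hi
  rw [← Real.rpow_mul (by linarith)]
  congr 1
  field_simp

lemma rpow_neg_bcoef_mem_Ioo {k i : ℕ} {δ z : ℝ} (hδ : -1 < δ) (hz : 1 < z) (hi : i ≤ k) :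
    z ^ (-(bcoef k δ i / bcoef k δ 0)) ∈ Set.Ioo (0 : ℝ) 1 := by
  have hi := bcoef_pos hδ hi
  have h0 := bcoef_pos hδ k.zero_le
  exact ⟨by positivity, Real.rpow_lt_one_of_one_lt_of_neg hz (neg_neg_of_pos (by positivity))⟩

lemma isProbabilityMeasure_natMeasure {f : ℕ → ℝ} (hf : ∀ l, 0 ≤ f l) (h : HasSum f 1) :
    IsProbabilityMeasure (natMeasure f) := by
  constructor
  have := lintegral_pow_natMeasure hf zero_le_one (S := 1) (by simpa using h)
  simpa using this

lemma isProbabilityMeasure_tnbWeight {κ a : ℝ} (hκ : 0 < κ) (hκ' : κ < 1)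
    (ha : a ∈ Set.Ioo (0 : ℝ) 1) : IsProbabilityMeasure (natMeasure (tnbWeight κ a)) := by
  refine isProbabilityMeasure_natMeasure (tnbWeight_nonneg hκ hκ' ha.1.le ha.2.le) ?_
  have h := hasSum_tnbWeight (a := a) (g := 1) hκ hκ'
    (by rw [abs_lt]; constructor <;> linarith [ha.1, ha.2])
  have h1 : 1 - a ^ κ ≠ 0 := by linarith [Real.rpow_lt_one ha.1.le ha.2 hκ]
  simpa [h1] using h

lemma isProbabilityMeasure_nbWeight {r a : ℝ} (hr : 0 < r)
    (ha : a ∈ Set.Ioo (0 : ℝ) 1) : IsProbabilityMeasure (natMeasure (nbWeight r a)) := by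
  refine isProbabilityMeasure_natMeasure (nbWeight_nonneg hr ha.1.le ha.2.le) ?_
  have h := hasSum_nbWeight (a := a) (g := 1) hr
    (by rw [abs_lt]; constructor <;> linarith [ha.1, ha.2])
  have h1 : a ^ r * a ^ (-r) = 1 := by rw [← Real.rpow_add ha.1]; simp
  simpa [h1] using h

lemma isProbabilityMeasure_bind {α β : Type*} [MeasurableSpace α] [MeasurableSpace β]
    [Countable α] [MeasurableSingletonClass α] {μ : Measure α} [IsProbabilityMeasure μ]
    {f : α → Measure β} (hf : ∀ a, IsProbabilityMeasure (f a)) :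
    IsProbabilityMeasure (μ.bind f) := by
  constructor
  rw [Measure.bind_apply MeasurableSet.univ (measurable_of_countable _).aemeasurable]
  simp

lemma isProbabilityMeasure_convPow {m : ℕ} (ν : Measure (Fin m → ℕ)) [IsProbabilityMeasure ν]
    (l : ℕ) : IsProbabilityMeasure (convPow ν l) := by
  induction l with
  | zero => exact Measure.dirac.isProbabilityMeasure
  | succ l ih => exact Measure.isProbabilityMeasure_map (measurable_of_countable _).aemeasurable

lemma tnb_shape_mem_Ioo {k m : ℕ} {δ : ℝ} (hδ : -1 < δ) (hm : m + 1 ≤ k) :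
    bcoef k δ (m + 1) / bcoef k δ m ∈ Set.Ioo (0 : ℝ) 1 := by
  have hb := bcoef_pos hδ hm
  have hb' := bcoef_pos hδ (Nat.le_of_succ_le hm)
  exact ⟨by positivity, (div_lt_one hb').2 (bcoef_succ_lt hδ)⟩

lemma isProbabilityMeasure_vecLaw {k : ℕ} {δ z : ℝ} (hδ : -1 < δ) (hz : 1 < z) {m : ℕ}
    (hm : m ≤ k) : IsProbabilityMeasure (vecLaw k δ z m) := by
  induction m with
  | zero => exact Measure.dirac.isProbabilityMeasure
  | succ m ih =>
    have := ih (Nat.le_of_succ_le hm)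
    obtain ⟨hκ, hκ'⟩ := tnb_shape_mem_Ioo hδ hm
    have := isProbabilityMeasure_tnbWeight hκ hκ'
      (rpow_neg_bcoef_mem_Ioo hδ hz (Nat.le_of_succ_le hm))
    refine isProbabilityMeasure_bind fun l => ?_
    have := isProbabilityMeasure_convPow (vecLaw k δ z m) l
    exact Measure.isProbabilityMeasure_map (measurable_of_countable _).aemeasurable

/-- The generating function of `N_i^{(m)}`. -/
lemma lintegral_pow_vecLaw {k : ℕ} {δ z : ℝ} (hδ : -1 < δ) (hz : 1 < z) {x : ℝ}
    (hx : x ∈ Set.Icc (0 : ℝ) 1) {m : ℕ} (hm : m ≤ k) {i : ℕ} (hi : i < m) :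
    ∫⁻ v, ENNReal.ofReal x ^ v ⟨i, hi⟩ ∂vecLaw k δ z m
      = ENNReal.ofReal ((1 - (1 - (1 - z ^ (-(bcoef k δ i / bcoef k δ 0))) * x)
          ^ (bcoef k δ m / bcoef k δ i)) / (1 - z ^ (-(bcoef k δ m / bcoef k δ 0)))) := by
  induction m with
  | zero => omega
  | succ m ih =>
    have hm' : m ≤ k := by omega
    have hb := bcoef_pos hδ hm
    have hb' := bcoef_pos hδ hm'
    obtain ⟨hκ, hκ'⟩ := tnb_shape_mem_Ioo hδ hm
    obtain ⟨ha, ha'⟩ := rpow_neg_bcoef_mem_Ioo hδ hz hm'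
    have hw := tnbWeight_nonneg hκ hκ' ha.le ha'.le
    rw [vecLaw, Measure.lintegral_bind (measurable_of_countable _).aemeasurable
      (measurable_of_countable _).aemeasurable]
    simp_rw [lintegral_map (measurable_of_countable _)
      (measurable_of_countable (α := Fin m → ℕ) _)]
    rcases (Nat.lt_succ_iff_lt_or_eq.mp hi) with him | rfl
    · simp only [Fin.snoc, him, dite_true, Fin.castLT_mk, cast_eq]
      simp_rw [lintegral_pow_convPow, ih hm' him]
      obtain ⟨h1, h2⟩ := rpow_neg_bcoef_mem_Ioo hδ hz (him.le.trans hm')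
      have hbi := bcoef_pos hδ (him.le.trans hm')
      set ai := z ^ (-(bcoef k δ i / bcoef k δ 0)) with hai
      set am := z ^ (-(bcoef k δ m / bcoef k δ 0)) with ham
      have hbase : 0 < 1 - (1 - ai) * x := by nlinarith [hx.1, hx.2]
      have hbase' : 1 - (1 - ai) * x ≤ 1 := by nlinarith [hx.1, hx.2]
      set P := (1 - (1 - ai) * x) ^ (bcoef k δ m / bcoef k δ i) with hP
      have hP0 : 0 < P := by positivity
      have hP1 : P ≤ 1 := Real.rpow_le_one hbase.le hbase' (by positivity)
      have hmul : (1 - am) * ((1 - P) / (1 - am)) = 1 - P := mul_div_cancel₀ _ (by linarith)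
      rw [lintegral_pow_natMeasure hw (div_nonneg (by linarith) (by linarith))
        (hasSum_tnbWeight hκ hκ' (by rw [hmul, abs_lt]; constructor <;> linarith)), hmul,
        sub_sub_cancel, ham, rpow_neg_bcoef_rpow hδ hz hm', hP, ← Real.rpow_mul hbase.le]
      congr 4
      field_simp
    · simp only [Fin.snoc, lt_irrefl, dite_false, cast_eq, lintegral_const]
      have := isProbabilityMeasure_vecLaw hδ hz hm'
      have := isProbabilityMeasure_convPow (vecLaw k δ z i)
      simp only [measure_univ, mul_one]
      rw [lintegral_pow_natMeasure hw hx.1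
        (hasSum_tnbWeight hκ hκ' (by rw [abs_lt]; constructor <;> nlinarith [hx.1, hx.2])),
        rpow_neg_bcoef_rpow hδ hz hm']

/-- The generating function of `Σ_{j=1}^{T_m} N_{i,j}^{(m)}`. -/
lemma lintegral_pow_pairLaw {k : ℕ} {δ z : ℝ} (hδ : -1 < δ) (hz : 1 < z) {x : ℝ}
    (hx : x ∈ Set.Icc (0 : ℝ) 1) {m : ℕ} (hm : m ≤ k) {i : ℕ} (hi : i < m) :
    ∫⁻ y, ENNReal.ofReal x ^ y.2 ⟨i, hi⟩ ∂pairLaw k δ z m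
      = ENNReal.ofReal ((z ^ (-(bcoef k δ i / bcoef k δ 0))) ^ ((1 + δ) / bcoef k δ i)
          * (1 - (1 - z ^ (-(bcoef k δ i / bcoef k δ 0))) * x)
          ^ (-((1 + δ) / bcoef k δ i))) := by
  have hb := bcoef_pos hδ hm
  have hbi := bcoef_pos hδ (hi.le.trans hm)
  have hδ' : 0 < 1 + δ := by linarith
  have hr : 0 < (1 + δ) / bcoef k δ m := by positivity
  obtain ⟨ha, ha'⟩ := rpow_neg_bcoef_mem_Ioo hδ hz hm
  rw [pairLaw, Measure.lintegral_bind (measurable_of_countable _).aemeasurable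
    (measurable_of_countable _).aemeasurable]
  simp_rw [lintegral_map (measurable_of_countable _)
    (measurable_of_countable (α := Fin m → ℕ) _), lintegral_pow_convPow,
    lintegral_pow_vecLaw hδ hz hx hm hi]
  obtain ⟨h1, h2⟩ := rpow_neg_bcoef_mem_Ioo hδ hz (hi.le.trans hm)
  have ham := rpow_neg_bcoef_rpow (m := m) hδ hz (hi.le.trans hm)
  set ai := z ^ (-(bcoef k δ i / bcoef k δ 0))
  set am := z ^ (-(bcoef k δ m / bcoef k δ 0))
  have hbase : 0 < 1 - (1 - ai) * x := by nlinarith [hx.1, hx.2]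
  have hbase' : 1 - (1 - ai) * x ≤ 1 := by nlinarith [hx.1, hx.2]
  set P := (1 - (1 - ai) * x) ^ (bcoef k δ m / bcoef k δ i) with hP
  have hP0 : 0 < P := by positivity
  have hP1 : P ≤ 1 := Real.rpow_le_one hbase.le hbase' (by positivity)
  have hmul : (1 - am) * ((1 - P) / (1 - am)) = 1 - P := mul_div_cancel₀ _ (by linarith)
  rw [lintegral_pow_natMeasure (nbWeight_nonneg hr ha.le ha'.le)
    (div_nonneg (by linarith) (by linarith))
    (hasSum_nbWeight hr (by rw [hmul, abs_lt]; constructor <;> linarith)), hmul,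
    sub_sub_cancel, ← ham, hP, ← Real.rpow_mul hbase.le, ← Real.rpow_mul h1.le]
  congr 3 <;> field_simp

lemma isProbabilityMeasure_pairLaw {k : ℕ} {δ z : ℝ} (hδ : -1 < δ) (hz : 1 < z) {m : ℕ}
    (hm : m ≤ k) : IsProbabilityMeasure (pairLaw k δ z m) := by
  have hb := bcoef_pos hδ hm
  have hδ' : 0 < 1 + δ := by linarith
  have := isProbabilityMeasure_vecLaw hδ hz hm
  have := isProbabilityMeasure_nbWeight (r := (1 + δ) / bcoef k δ m) (by positivity)
    (rpow_neg_bcoef_mem_Ioo hδ hz hm)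
  refine isProbabilityMeasure_bind fun l => ?_
  have := isProbabilityMeasure_convPow (vecLaw k δ z m) l
  exact Measure.isProbabilityMeasure_map (measurable_of_countable _).aemeasurable

/-- For `0 ≤ i < m ≤ k` and `z > 1`, the compound sum `Σ_{j=1}^{T_m} N_{i,j}^{(m)}` has the
negative binomial distribution with shape `(1+δ)/b_i` and success probability `z^{-b_i/b_0}`;
equivalently its probability generating function is
`x ↦ (x(1 - z^{b_i/b_0}) + z^{b_i/b_0})^{-(1+δ)/b_i}`. -/
theorem compound_sum_negative_binomial (k : ℕ) (δ : ℝ) (hδ : -1 < δ)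
    (z : ℝ) (hz : 1 < z) (i m : ℕ) (him : i < m) (hmk : m ≤ k) :
    (∀ ℓ : ℕ, pairLaw k δ z m {y | y.2 ⟨i, him⟩ = ℓ}
        = ENNReal.ofReal (nbWeight ((1 + δ) / bcoef k δ i)
            (z ^ (-(bcoef k δ i / bcoef k δ 0))) ℓ)) ∧
    ∀ x : ℝ, x ∈ Set.Icc (0 : ℝ) 1 →
      (∫ y, x ^ (y.2 ⟨i, him⟩) ∂(pairLaw k δ z m))
        = (x * (1 - z ^ (bcoef k δ i / bcoef k δ 0)) + z ^ (bcoef k δ i / bcoef k δ 0))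
            ^ (-((1 + δ) / bcoef k δ i)) := by
  have hik : i ≤ k := him.le.trans hmk
  have hbi := bcoef_pos hδ hik
  have hδ' : 0 < 1 + δ := by linarith
  have hr : 0 < (1 + δ) / bcoef k δ i := by positivity
  have ha := rpow_neg_bcoef_mem_Ioo hδ hz hik
  constructor
  · intro ℓ
    have := isProbabilityMeasure_pairLaw hδ hz hmk
    have := isProbabilityMeasure_nbWeight hr ha
    have hmeas : Measurable fun y : ℕ × (Fin m → ℕ) => y.2 ⟨i, him⟩ := measurable_of_countable _
    have := Measure.isProbabilityMeasure_map (μ := pairLaw k δ z m) hmeas.aemeasurable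
    have heq : (pairLaw k δ z m).map (fun y => y.2 ⟨i, him⟩) = natMeasure (nbWeight
        ((1 + δ) / bcoef k δ i) (z ^ (-(bcoef k δ i / bcoef k δ 0)))) := by
      refine measure_nat_ext_of_lintegral_pow fun x hx => ?_
      rw [lintegral_map (measurable_of_countable _) hmeas,
        lintegral_pow_pairLaw hδ hz (Set.Ioo_subset_Icc_self hx) hmk him,
        lintegral_pow_natMeasure (nbWeight_nonneg hr ha.1.le ha.2.le) hx.1.le
          (hasSum_nbWeight hr (by
            rw [abs_lt]; constructor <;> nlinarith [hx.1, hx.2, ha.1, ha.2]))]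
    have h := congrArg (fun μ => μ {ℓ}) heq
    rw [Measure.map_apply hmeas (measurableSet_singleton ℓ), natMeasure,
      Measure.sum_smul_dirac_singleton] at h
    exact h
  · intro x hx
    rw [integral_eq_lintegral_of_nonneg_ae (ae_of_all _ fun y => pow_nonneg hx.1 _)
      (measurable_of_countable _).aestronglyMeasurable]
    simp_rw [ENNReal.ofReal_pow hx.1]
    have hbase : 0 < 1 - (1 - z ^ (-(bcoef k δ i / bcoef k δ 0))) * x := by
      nlinarith [hx.1, hx.2, ha.1, ha.2]
    have ha0 := ha.1
    rw [lintegral_pow_pairLaw hδ hz hx hmk him, ENNReal.toReal_ofReal (by positivity)]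
    rw [Real.rpow_neg (by linarith) (bcoef k δ i / bcoef k δ 0)] at *
    set w := z ^ (bcoef k δ i / bcoef k δ 0)
    have hw : 0 < w := inv_pos.mp ha0
    have h1 : x * (1 - w) + w = w * (1 - (1 - w⁻¹) * x) := by
      field_simp
      ring
    rw [h1, Real.mul_rpow hw.le hbase.le, Real.inv_rpow hw.le, Real.rpow_neg hw.le]
end
end

section
/- Let (p_{i_0,…,i_k}) be the unique solution of the limiting degree recursion and define the joint probability generating function φ(x_0,…,x_k) := Σ_{1≤i_k<⋯<i_0} p_{i_0,…,i_k} Π_{ℓ=0}^{k} x_ℓ^{i_ℓ}. Then φ is differentiable on (0,1)^{k+1} and satisfies there the first-order linear partial differential equation Σ_{m=0}^{k} a_m(x_0,…,x_k) ∂φ/∂x_m = c(x_0,…,x_k) φ(x_0,…,x_k) + d(x_0,…,x_k), where a_m(x) = b_m(1−x_m) Π_{ℓ=0}^{m} x_ℓ, c(x) = γ − Σ_{m=0}^{k} γ_m Π_{ℓ=0}^{m} x_ℓ, d(x) = τ Π_{ℓ=0}^{k} x_ℓ^{k−ℓ+1}, with γ = k²−2+δ(k²−k−2) and γ_m = 2(k−m)+δ(2(k−m)−1).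 -/
open MeasureTheory Filter Finset

noncomputable section

/-- A vector `(i_0, …, i_k)` of degrees is valid when `1 ≤ i_k < i_{k-1} < ⋯ < i_0`. -/
def ValidIdx (k : ℕ) (i : Fin (k + 1) → ℕ) : Prop :=
  1 ≤ i (Fin.last k) ∧ StrictAnti i

/-- Decrease every coordinate of the index vector by one. -/
def allDec (k : ℕ) (i : Fin (k + 1) → ℕ) : Fin (k + 1) → ℕ := fun ℓ => i ℓ - 1

/-- Decrease the coordinates `0, …, m` of the index vector by one. -/
def decUpTo (k : ℕ) (m : ℕ) (i : Fin (k + 1) → ℕ) : Fin (k + 1) → ℕ :=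
  fun ℓ => if (ℓ : ℕ) ≤ m then i ℓ - 1 else i ℓ

/-- The limiting degree recursion: `p` vanishes outside the valid index vectors, and on the
valid index vectors it satisfies the recursion of Theorem 2.1 of the paper. -/
def LimitRecursion (k : ℕ) (δ : ℝ) (p : (Fin (k + 1) → ℕ) → ℝ) : Prop :=
  (∀ i, ¬ ValidIdx k i → p i = 0) ∧
  ∀ i, ValidIdx k i →
    p i = ((i (Fin.last k) : ℝ) - 1 + δ) / tauc k δ * p (allDec k i)
      + (∑ m : Fin k,
          (((i m.castSucc : ℝ) - 1 - k + (m : ℕ)) * bcoef k δ (m : ℕ)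
            - ((i m.succ : ℝ) - k + (m : ℕ) + 1) * bcoef k δ ((m : ℕ) + 1)) / tauc k δ
            * p (decUpTo k (m : ℕ) i))
      - (((i 0 : ℝ) - k) * bcoef k δ 0 + δ) / tauc k δ * p i
      + (if ∀ ℓ : Fin (k + 1), i ℓ = k - (ℓ : ℕ) + 1 then (1 : ℝ) else 0)

/-- The joint probability generating function of the family `p`. -/
def pgfFun (k : ℕ) (p : (Fin (k + 1) → ℕ) → ℝ) (x : Fin (k + 1) → ℝ) : ℝ :=
  ∑' i : Fin (k + 1) → ℕ, p i * ∏ ℓ : Fin (k + 1), x ℓ ^ i ℓ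

lemma one_le_bcoef {k : ℕ} {δ : ℝ} (hδ : -1 < δ) {m : ℕ} (hm : m ≤ k) : 1 ≤ bcoef k δ m := by
  have h : (m : ℝ) ≤ k := by exact_mod_cast hm
  unfold bcoef
  nlinarith

lemma bcoef_eq_succ_add (k : ℕ) (δ : ℝ) (m : ℕ) :
    bcoef k δ m = bcoef k δ (m + 1) + 1 + δ := by
  unfold bcoef
  push_cast
  ring

lemma tauc_pos {k : ℕ} {δ : ℝ} (hδ : -1 < δ) : 0 < tauc k δ := by
  have h : (0 : ℝ) ≤ k := Nat.cast_nonneg k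
  unfold tauc
  nlinarith

/-- Increase the coordinates `0, …, m` of the index vector by one. -/
def incUpTo (k : ℕ) (m : ℕ) (i : Fin (k + 1) → ℕ) : Fin (k + 1) → ℕ :=
  fun ℓ => if (ℓ : ℕ) ≤ m then i ℓ + 1 else i ℓ

lemma decUpTo_incUpTo (k m : ℕ) (j : Fin (k + 1) → ℕ) : decUpTo k m (incUpTo k m j) = j := by
  funext ℓ
  unfold decUpTo incUpTo
  split_ifs <;> simp

lemma incUpTo_injective (k m : ℕ) : Function.Injective (incUpTo k m) :=
  Function.LeftInverse.injective (decUpTo_incUpTo k m)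

lemma ValidIdx.one_le {k : ℕ} {i : Fin (k + 1) → ℕ} (hi : ValidIdx k i) (ℓ : Fin (k + 1)) :
    1 ≤ i ℓ :=
  hi.1.trans (hi.2.antitone (Fin.le_last ℓ))

lemma incUpTo_decUpTo {k : ℕ} (m : ℕ) {i : Fin (k + 1) → ℕ} (hi : ValidIdx k i) :
    incUpTo k m (decUpTo k m i) = i := by
  funext ℓ
  have := hi.one_le ℓ
  simp only [decUpTo, incUpTo]
  split_ifs <;> omega

lemma ValidIdx.incUpTo {k : ℕ} (m : ℕ) {j : Fin (k + 1) → ℕ} (hj : ValidIdx k j) :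
    ValidIdx k (incUpTo k m j) := by
  refine ⟨?_, fun a b hab => ?_⟩
  · have := hj.1
    unfold _root_.incUpTo
    split_ifs <;> omega
  · have := hj.2 hab
    have hab' : (a : ℕ) < b := hab
    unfold _root_.incUpTo
    split_ifs <;> omega

lemma allDec_eq_decUpTo (k : ℕ) (i : Fin (k + 1) → ℕ) : allDec k i = decUpTo k k i := by
  funext ℓ
  simp [allDec, decUpTo, Nat.lt_succ_iff.mp ℓ.isLt]

lemma ValidIdx.lt_add {k : ℕ} {i : Fin (k + 1) → ℕ} (hi : ValidIdx k i) (ℓ : Fin (k + 1)) :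
    k < i ℓ + ℓ := by
  induction ℓ using Fin.reverseInduction with
  | last => have := hi.1; simp; omega
  | cast m ih =>
    have := hi.2 (Fin.castSucc_lt_succ (i := m))
    simp only [Fin.val_succ, Fin.val_castSucc] at *
    omega

lemma validIdx_minimal (k : ℕ) : ValidIdx k (fun ℓ => k - (ℓ : ℕ) + 1) := by
  refine ⟨by simp, fun a b hab => ?_⟩
  have hab' : (a : ℕ) < b := hab
  have := b.isLt
  show k - (b : ℕ) + 1 < k - (a : ℕ) + 1
  omega

lemma abs_transition_mul_le {k : ℕ} {δ : ℝ} (hδ : -1 < δ) {p : (Fin (k + 1) → ℕ) → ℝ}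
    (hp : ∀ i, ¬ ValidIdx k i → p i = 0) {i : Fin (k + 1) → ℕ} (hi : ValidIdx k i) (m : Fin k)
    (hle : |p (decUpTo k m i)| ≤ 1) :
    |(((i m.castSucc : ℝ) - 1 - k + (m : ℕ)) * bcoef k δ (m : ℕ)
        - ((i m.succ : ℝ) - k + (m : ℕ) + 1) * bcoef k δ ((m : ℕ) + 1))
          * p (decUpTo k (m : ℕ) i)|
      ≤ ((i m.castSucc : ℝ) - 1 - k + (m : ℕ)) * bcoef k δ (m : ℕ)
        - ((i m.succ : ℝ) - 1 - k + ((m : ℕ) + 1 : ℕ)) * bcoef k δ ((m : ℕ) + 1) := by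
  have hb : 1 ≤ bcoef k δ ((m : ℕ) + 1) := one_le_bcoef hδ m.isLt
  have hb' := bcoef_eq_succ_add k δ m
  have h1 : (i m.succ : ℝ) + 1 ≤ i m.castSucc := by
    exact_mod_cast hi.2 (Fin.castSucc_lt_succ (i := m))
  have h2 : (k : ℝ) + 1 ≤ i m.castSucc + (m : ℕ) := by
    have := hi.lt_add m.castSucc
    simp only [Fin.val_castSucc] at this
    exact_mod_cast this
  push_cast
  rw [hb']
  set B := bcoef k δ ((m : ℕ) + 1)
  by_cases hv : ValidIdx k (decUpTo k m i)
  · have h3 : (i m.succ : ℝ) + 2 ≤ i m.castSucc := by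
      have h := hv.2 (Fin.castSucc_lt_succ (i := m))
      have := hi.one_le m.castSucc
      simp only [decUpTo, Fin.val_succ, Fin.val_castSucc] at h
      rw [if_neg (by omega), if_pos le_rfl] at h
      have : i m.succ + 2 ≤ i m.castSucc := by omega
      exact_mod_cast this
    have hnn : 0 ≤ ((i m.castSucc : ℝ) - 1 - k + (m : ℕ)) * (B + 1 + δ)
        - ((i m.succ : ℝ) - k + (m : ℕ) + 1) * B := by
      nlinarith [mul_nonneg (by linarith : 0 ≤ (i m.castSucc : ℝ) - i m.succ - 2)
        (by linarith : 0 ≤ B), mul_nonneg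
        (by linarith : 0 ≤ (i m.castSucc : ℝ) - 1 - k + (m : ℕ)) (by linarith : 0 ≤ 1 + δ)]
    rw [abs_mul, abs_of_nonneg hnn]
    nlinarith [mul_le_of_le_one_right hnn hle]
  · rw [hp _ hv, mul_zero, abs_zero]
    nlinarith [mul_nonneg (by linarith : 0 ≤ (i m.castSucc : ℝ) - i m.succ - 1)
        (by linarith : 0 ≤ B), mul_nonneg
        (by linarith : 0 ≤ (i m.castSucc : ℝ) - 1 - k + (m : ℕ)) (by linarith : 0 ≤ 1 + δ)]

lemma sum_fin_sub_succ {k : ℕ} (g : Fin (k + 1) → ℝ) :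
    ∑ m : Fin k, (g m.castSucc - g m.succ) = g 0 - g (Fin.last k) := by
  have h := Fin.sum_univ_castSucc g
  rw [Fin.sum_univ_succ] at h
  rw [Finset.sum_sub_distrib]
  linarith

/-- On valid index vectors the recursion can be multiplied out by `τ`. -/
lemma LimitRecursion.tauc_mul {k : ℕ} {δ : ℝ} (hδ : -1 < δ) {p : (Fin (k + 1) → ℕ) → ℝ}
    (hp : LimitRecursion k δ p) {i : Fin (k + 1) → ℕ} (hi : ValidIdx k i) :
    tauc k δ * p i = ((i (Fin.last k) : ℝ) - 1 + δ) * p (decUpTo k k i)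
      + (∑ m : Fin k,
          (((i m.castSucc : ℝ) - 1 - k + (m : ℕ)) * bcoef k δ (m : ℕ)
            - ((i m.succ : ℝ) - k + (m : ℕ) + 1) * bcoef k δ ((m : ℕ) + 1))
            * p (decUpTo k (m : ℕ) i))
      - (((i 0 : ℝ) - k) * bcoef k δ 0 + δ) * p i
      + tauc k δ * (if ∀ ℓ : Fin (k + 1), i ℓ = k - (ℓ : ℕ) + 1 then (1 : ℝ) else 0) := by
  have hτ := (tauc_pos (k := k) hδ).ne'
  have h := congrArg (tauc k δ * ·) (hp.2 i hi)
  simp only [mul_add, mul_sub, Finset.mul_sum, allDec_eq_decUpTo] at h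
  rw [h]
  congr 2
  · congr 1
    · field_simp
    · refine Finset.sum_congr rfl fun m _ => ?_
      field_simp
  · field_simp

lemma LimitRecursion.abs_le_one {k : ℕ} {δ : ℝ} (hδ : -1 < δ) {p : (Fin (k + 1) → ℕ) → ℝ}
    (hp : LimitRecursion k δ p) (i : Fin (k + 1) → ℕ) : |p i| ≤ 1 := by
  obtain ⟨n, hn⟩ : ∃ n, i 0 = n := ⟨_, rfl⟩
  induction n using Nat.strong_induction_on generalizing i with
  | _ n ih =>
  by_cases hi : ValidIdx k i
  swap
  · simp [hp.1 i hi]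
  have hdec : ∀ m, |p (decUpTo k m i)| ≤ 1 := fun m => by
    have := hi.one_le 0
    exact ih (i 0 - 1) (by omega) _ (by simp [decUpTo])
  have hlast : |((i (Fin.last k) : ℝ) - 1 + δ) * p (decUpTo k k i)| ≤ i (Fin.last k) + δ := by
    have h1 : (1 : ℝ) ≤ i (Fin.last k) := by exact_mod_cast hi.1
    by_cases hv : ValidIdx k (decUpTo k k i)
    · have h2 : (2 : ℝ) ≤ i (Fin.last k) := by
        have h := hv.1
        simp only [decUpTo, Fin.val_last, le_refl, if_true] at h
        have : 2 ≤ i (Fin.last k) := by omega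
        exact_mod_cast this
      have hnn : 0 ≤ (i (Fin.last k) : ℝ) - 1 + δ := by linarith
      rw [abs_mul, abs_of_nonneg hnn]
      linarith [mul_le_of_le_one_right hnn (hdec k)]
    · rw [hp.1 _ hv, mul_zero, abs_zero]
      linarith
  have hsum := (Finset.abs_sum_le_sum_abs _ _).trans
    (Finset.sum_le_sum fun m (_ : m ∈ (Finset.univ : Finset (Fin k))) =>
      abs_transition_mul_le hδ hp.1 hi m (hdec m))
  have htel := sum_fin_sub_succ
    (fun m : Fin (k + 1) => ((i m : ℝ) - 1 - k + (m : ℕ)) * bcoef k δ (m : ℕ))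
  simp only [Fin.val_castSucc, Fin.val_succ, Fin.val_zero, Fin.val_last] at htel
  rw [htel] at hsum
  have hbk : bcoef k δ k = 1 := by simp [bcoef]
  have hb0 := one_le_bcoef hδ (Nat.zero_le k)
  have hτ := tauc_pos (k := k) hδ
  have hind : |tauc k δ * (if ∀ ℓ : Fin (k + 1), i ℓ = k - (ℓ : ℕ) + 1 then (1 : ℝ) else 0)|
      ≤ tauc k δ := by
    split_ifs
    · rw [mul_one, abs_of_pos hτ]
    · simpa using hτ.le
  have hi0 : (k : ℝ) + 1 ≤ i 0 := by
    have := hi.lt_add 0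
    simp only [Fin.val_zero, add_zero] at this
    exact_mod_cast this
  have hτδ : 0 < tauc k δ + δ + ((i 0 : ℝ) - k) * bcoef k δ 0 := by
    have : 0 < tauc k δ + δ := by
      have h : (0 : ℝ) ≤ k := Nat.cast_nonneg k
      unfold tauc
      nlinarith
    nlinarith
  have heq := hp.tauc_mul hδ hi
  rw [hbk] at hsum
  simp only [Nat.cast_zero, add_zero, mul_one] at hsum
  rw [abs_le] at hlast hsum hind
  rw [abs_le]
  constructor
  · nlinarith
  · nlinarith

lemma summable_prod_pi {ι : Type*} [Fintype ι] [DecidableEq ι] {f : ι → ℕ → ℝ}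
    (hf0 : ∀ a n, 0 ≤ f a n) (hf : ∀ a, Summable (f a)) :
    Summable fun i : ι → ℕ => ∏ a, f a (i a) := by
  refine summable_of_sum_le (c := ∏ a, ∑' n, f a n)
    (fun i => Finset.prod_nonneg fun a _ => hf0 a _) fun s => ?_
  calc ∑ i ∈ s, ∏ a, f a (i a)
      ≤ ∑ i ∈ Fintype.piFinset fun a => s.image (fun i => i a), ∏ a, f a (i a) := by
        refine Finset.sum_le_sum_of_subset_of_nonneg (fun i hi => ?_)
          fun i _ _ => Finset.prod_nonneg fun a _ => hf0 a _
        exact Fintype.mem_piFinset.mpr fun a => Finset.mem_image_of_mem _ hi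
    _ = ∏ a, ∑ n ∈ s.image (fun i => i a), f a n := (Finset.prod_univ_sum _ _).symm
    _ ≤ ∏ a, ∑' n, f a n :=
        Finset.prod_le_prod (fun a _ => Finset.sum_nonneg fun n _ => hf0 a n)
          fun a _ => (hf a).sum_le_tsum _ fun n _ => hf0 a n

lemma summable_prod_succ_mul_pow {ι : Type*} [Fintype ι] [DecidableEq ι] {x : ι → ℝ}
    (hx : ∀ a, x a ∈ Set.Ioo (0 : ℝ) 1) :
    Summable fun i : ι → ℕ => ∏ a, ((i a : ℝ) + 1) * x a ^ i a := by
  refine summable_prod_pi (f := fun a n => ((n : ℝ) + 1) * x a ^ n)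
    (fun a n => by have := (hx a).1; positivity) fun a => ?_
  have hn : ‖x a‖ < 1 := by rw [Real.norm_of_nonneg (hx a).1.le]; exact (hx a).2
  simpa [add_mul] using (summable_pow_mul_geometric_of_norm_lt_one 1 hn).add
    (summable_geometric_of_norm_lt_one hn)

lemma natCast_le_prod_succ {ι : Type*} [Fintype ι] (i : ι → ℕ) (a : ι) :
    (i a : ℝ) ≤ ∏ b, ((i b : ℝ) + 1) :=
  calc (i a : ℝ) ≤ (i a : ℝ) + 1 := by linarith
    _ ≤ ∏ b, ((i b : ℝ) + 1) := by
      have h : i a + 1 ≤ ∏ b, (i b + 1) :=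
        Finset.single_le_prod' (f := fun b => i b + 1) (fun b _ => by simp) (Finset.mem_univ a)
      exact_mod_cast h

lemma summable_coord_mul {k : ℕ} {p : (Fin (k + 1) → ℕ) → ℝ} (hp : ∀ i, |p i| ≤ 1)
    {x : Fin (k + 1) → ℝ} (hx : ∀ ℓ, x ℓ ∈ Set.Ioo (0 : ℝ) 1) (m : Fin (k + 1)) :
    Summable fun i : Fin (k + 1) → ℕ => (i m : ℝ) * (p i * ∏ ℓ, x ℓ ^ i ℓ) := by
  refine Summable.of_norm_bounded (summable_prod_succ_mul_pow hx) fun i => ?_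
  have h0 : 0 ≤ ∏ ℓ, x ℓ ^ i ℓ := Finset.prod_nonneg fun ℓ _ => pow_nonneg (hx ℓ).1.le _
  rw [Finset.prod_mul_distrib, Real.norm_eq_abs, abs_mul, abs_mul, abs_of_nonneg h0, Nat.abs_cast]
  exact mul_le_mul (natCast_le_prod_succ i m) (mul_le_of_le_one_left h0 (hp i)) (by positivity)
    (Finset.prod_nonneg fun _ _ => by positivity)

lemma summable_mul_prod_pow {k : ℕ} {p : (Fin (k + 1) → ℕ) → ℝ} (hp : ∀ i, |p i| ≤ 1)
    {x : Fin (k + 1) → ℝ} (hx : ∀ ℓ, x ℓ ∈ Set.Ioo (0 : ℝ) 1) :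
    Summable fun i : Fin (k + 1) → ℕ => p i * ∏ ℓ, x ℓ ^ i ℓ := by
  refine Summable.of_norm_bounded (summable_prod_succ_mul_pow hx) fun i => ?_
  have h0 : 0 ≤ ∏ ℓ, x ℓ ^ i ℓ := Finset.prod_nonneg fun ℓ _ => pow_nonneg (hx ℓ).1.le _
  rw [Finset.prod_mul_distrib, Real.norm_eq_abs, abs_mul, abs_of_nonneg h0]
  refine mul_le_mul ((hp i).trans ?_) le_rfl h0 (Finset.prod_nonneg fun _ _ => by positivity)
  exact Finset.one_le_prod fun ℓ _ => by simp

/-- The derivative of the monomial `x ↦ ∏ x_ℓ ^ i_ℓ` at a point. -/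
def monomialDeriv {k : ℕ} (i : Fin (k + 1) → ℕ) (x : Fin (k + 1) → ℝ) :
    (Fin (k + 1) → ℝ) →L[ℝ] ℝ :=
  ∑ m, (∏ ℓ ∈ Finset.univ.erase m, x ℓ ^ i ℓ) •
    (((i m : ℝ) * x m ^ (i m - 1)) • ContinuousLinearMap.proj (R := ℝ) m)

lemma hasFDerivAt_monomial {k : ℕ} (i : Fin (k + 1) → ℕ) (x : Fin (k + 1) → ℝ) :
    HasFDerivAt (fun y : Fin (k + 1) → ℝ => ∏ ℓ, y ℓ ^ i ℓ) (monomialDeriv i x) x := by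
  refine HasFDerivAt.finsetProd fun m _ => ?_
  have h := (hasDerivAt_pow (i m) (x m)).comp_hasFDerivAt x
    (hasFDerivAt_apply (𝕜 := ℝ) m x)
  exact h

lemma mul_monomialDeriv_single {k : ℕ} (i : Fin (k + 1) → ℕ) (x : Fin (k + 1) → ℝ)
    (m : Fin (k + 1)) :
    x m * monomialDeriv i x (Pi.single m 1) = (i m : ℝ) * ∏ ℓ, x ℓ ^ i ℓ := by
  unfold monomialDeriv
  rw [_root_.sum_apply, Finset.sum_eq_single m]
  · rw [← Finset.prod_erase_mul _ _ (Finset.mem_univ m)]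
    rcases Nat.eq_zero_or_pos (i m) with h | h
    · simp [h]
    · have : x m ^ i m = x m * x m ^ (i m - 1) := by rw [← pow_succ']; congr 1; omega
      simp [this]
      ring
  · intro b _ hb
    simp [Pi.single_eq_of_ne hb]
  · simp

lemma norm_monomialDeriv_le {k : ℕ} (i : Fin (k + 1) → ℕ) {x : Fin (k + 1) → ℝ} {r : ℝ}
    (hr : 0 < r) (hx : ∀ ℓ, x ℓ ∈ Set.Ioo 0 r) :
    ‖monomialDeriv i x‖ ≤ ((k + 1 : ℕ) : ℝ) * (r⁻¹ * ∏ ℓ, ((i ℓ : ℝ) + 1) * r ^ i ℓ) := by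
  have hterm : ∀ m ∈ (Finset.univ : Finset (Fin (k + 1))),
      ‖(∏ ℓ ∈ Finset.univ.erase m, x ℓ ^ i ℓ) •
        (((i m : ℝ) * x m ^ (i m - 1)) • ContinuousLinearMap.proj (R := ℝ)
          (φ := fun _ : Fin (k + 1) => ℝ) m)‖ ≤ r⁻¹ * ∏ ℓ, ((i ℓ : ℝ) + 1) * r ^ i ℓ := by
    intro m _
    have hproj : ‖ContinuousLinearMap.proj (R := ℝ) (φ := fun _ : Fin (k + 1) => ℝ) m‖ ≤ 1 :=
      ContinuousLinearMap.opNorm_le_bound _ zero_le_one fun v => by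
        simpa using norm_le_pi_norm v m
    have h1 : 0 ≤ ∏ ℓ ∈ Finset.univ.erase m, x ℓ ^ i ℓ :=
      Finset.prod_nonneg fun ℓ _ => pow_nonneg (hx ℓ).1.le _
    have h1' : ∏ ℓ ∈ Finset.univ.erase m, x ℓ ^ i ℓ ≤ ∏ ℓ ∈ Finset.univ.erase m, r ^ i ℓ :=
      Finset.prod_le_prod (fun ℓ _ => pow_nonneg (hx ℓ).1.le _)
        fun ℓ _ => pow_le_pow_left₀ (hx ℓ).1.le (hx ℓ).2.le _
    have h2 : 0 ≤ (i m : ℝ) * x m ^ (i m - 1) :=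
      mul_nonneg (Nat.cast_nonneg _) (pow_nonneg (hx m).1.le _)
    have h2' : (i m : ℝ) * x m ^ (i m - 1) ≤ (i m : ℝ) * (r⁻¹ * r ^ i m) := by
      rcases Nat.eq_zero_or_pos (i m) with h | h
      · simp [h]
      · have : r⁻¹ * r ^ i m = r ^ (i m - 1) := by
          obtain ⟨n, hn⟩ : ∃ n, i m = n + 1 := ⟨i m - 1, by omega⟩
          rw [hn, pow_succ']
          simp [hr.ne']
        rw [this]
        exact mul_le_mul_of_nonneg_left (pow_le_pow_left₀ (hx m).1.le (hx m).2.le _)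
          (Nat.cast_nonneg _)
    rw [norm_smul, norm_smul, Real.norm_of_nonneg h1, Real.norm_of_nonneg h2]
    calc _ ≤ (∏ ℓ ∈ Finset.univ.erase m, r ^ i ℓ) * ((i m : ℝ) * (r⁻¹ * r ^ i m)) :=
          mul_le_mul h1' ((mul_le_of_le_one_right h2 hproj).trans h2')
            (mul_nonneg h2 (norm_nonneg _)) (h1.trans h1')
      _ = (i m : ℝ) * (r⁻¹ * ∏ ℓ, r ^ i ℓ) := by
          rw [← Finset.prod_erase_mul _ _ (Finset.mem_univ m)]
          ring
      _ ≤ (∏ ℓ, ((i ℓ : ℝ) + 1)) * (r⁻¹ * ∏ ℓ, r ^ i ℓ) :=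
          mul_le_mul_of_nonneg_right (natCast_le_prod_succ i m) (by positivity)
      _ = _ := by
          rw [Finset.prod_mul_distrib]
          ring
  refine (norm_sum_le_of_le _ hterm).trans ?_
  simp

/-- Coordinates in `(0,1)` admit a common upper bound in `(0,1)`. -/
lemma exists_common_bound {k : ℕ} {x : Fin (k + 1) → ℝ} (hx : ∀ ℓ, x ℓ ∈ Set.Ioo (0 : ℝ) 1) :
    ∃ r ∈ Set.Ioo (0 : ℝ) 1, ∀ ℓ, x ℓ ∈ Set.Ioo 0 r := by
  obtain ⟨a, ha⟩ := Finite.exists_max x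
  obtain ⟨r, hr, hr1⟩ := exists_between (hx a).2
  exact ⟨r, ⟨(hx a).1.trans hr, hr1⟩, fun ℓ => ⟨(hx ℓ).1, (ha ℓ).trans_lt hr⟩⟩

lemma pgfFun_derivative {k : ℕ} {p : (Fin (k + 1) → ℕ) → ℝ} (hp : ∀ i, |p i| ≤ 1)
    {x : Fin (k + 1) → ℝ} (hx : ∀ ℓ, x ℓ ∈ Set.Ioo (0 : ℝ) 1) :
    HasFDerivAt (pgfFun k p) (∑' i, p i • monomialDeriv i x) x ∧
      Summable fun i => p i • monomialDeriv i x := by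
  obtain ⟨r, hr, hxr⟩ := exists_common_bound hx
  set u : (Fin (k + 1) → ℕ) → ℝ :=
    fun i => ((k + 1 : ℕ) : ℝ) * (r⁻¹ * ∏ ℓ, ((i ℓ : ℝ) + 1) * r ^ i ℓ)
  have hu : Summable u :=
    ((summable_prod_succ_mul_pow (x := fun _ : Fin (k + 1) => r) fun _ => hr).mul_left _).mul_left _
  set s : Set (Fin (k + 1) → ℝ) := Set.univ.pi fun _ => Set.Ioo 0 r
  have hs : IsOpen s := isOpen_set_pi Set.finite_univ fun _ _ => isOpen_Ioo
  have hs' : IsPreconnected s := (convex_pi fun _ _ => convex_Ioo 0 r).isPreconnected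
  have hxs : x ∈ s := fun ℓ _ => hxr ℓ
  have hbound : ∀ i, ∀ y ∈ s, ‖p i • monomialDeriv i y‖ ≤ u i := fun i y hy => by
    rw [norm_smul]
    exact (mul_le_of_le_one_left (norm_nonneg _) (hp i)).trans
      (norm_monomialDeriv_le i hr.1 fun ℓ => hy ℓ (Set.mem_univ ℓ))
  exact ⟨hasFDerivAt_tsum_of_isPreconnected hu hs hs'
    (fun i y _ => (hasFDerivAt_monomial i y).const_mul (p i)) hbound hxs
    (summable_mul_prod_pow hp hx) hxs,
    Summable.of_norm_bounded hu fun i => hbound i x hxs⟩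

lemma mul_fderiv_pgfFun_single {k : ℕ} {p : (Fin (k + 1) → ℕ) → ℝ} (hp : ∀ i, |p i| ≤ 1)
    {x : Fin (k + 1) → ℝ} (hx : ∀ ℓ, x ℓ ∈ Set.Ioo (0 : ℝ) 1) (m : Fin (k + 1)) :
    x m * fderiv ℝ (pgfFun k p) x (Pi.single m 1)
      = ∑' i : Fin (k + 1) → ℕ, (i m : ℝ) * (p i * ∏ ℓ, x ℓ ^ i ℓ) := by
  obtain ⟨hd, hsum⟩ := pgfFun_derivative hp hx
  have h := ((hsum.hasSum.mapL (ContinuousLinearMap.apply ℝ ℝ (Pi.single m 1))).mul_left (x m))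
  rw [hd.fderiv]
  refine (h.tsum_eq.symm.trans (tsum_congr fun i => ?_))
  simp only [ContinuousLinearMap.apply_apply, _root_.smul_apply, smul_eq_mul]
  rw [mul_left_comm, mul_monomialDeriv_single]
  ring

lemma prod_pow_incUpTo {k : ℕ} (x : Fin (k + 1) → ℝ) (m : Fin (k + 1)) (j : Fin (k + 1) → ℕ) :
    ∏ ℓ, x ℓ ^ incUpTo k m j ℓ
      = (∏ ℓ ∈ Finset.univ.filter (· ≤ m), x ℓ) * ∏ ℓ, x ℓ ^ j ℓ := by
  rw [Finset.prod_filter, ← Finset.prod_mul_distrib]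
  refine Finset.prod_congr rfl fun ℓ _ => ?_
  by_cases h : ℓ ≤ m
  · have h' : (ℓ : ℕ) ≤ m := h
    simp [incUpTo, h, pow_succ']
  · have h' : ¬ (ℓ : ℕ) ≤ m := h
    simp [incUpTo, h]

/-- Reindexing a transition term of the recursion by the index vector before the transition. -/
lemma hasSum_indicator_transition {k : ℕ} {p : (Fin (k + 1) → ℕ) → ℝ}
    (hp : ∀ i, ¬ ValidIdx k i → p i = 0) (x : Fin (k + 1) → ℝ) (m : Fin (k + 1))
    {C D : (Fin (k + 1) → ℕ) → ℝ} (hCD : ∀ j, C (incUpTo k m j) = D j) {S : ℝ}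
    (h : HasSum (fun j => D j * (p j * ∏ ℓ, x ℓ ^ j ℓ)) S) :
    HasSum ({i | ValidIdx k i}.indicator
      fun i => C i * p (decUpTo k m i) * ∏ ℓ, x ℓ ^ i ℓ)
      ((∏ ℓ ∈ Finset.univ.filter (· ≤ m), x ℓ) * S) := by
  rw [← (incUpTo_injective k m).hasSum_iff]
  · refine (h.mul_left _).congr_fun fun j => ?_
    by_cases hj : ValidIdx k j
    · have hmem : incUpTo k m j ∈ {i | ValidIdx k i} := hj.incUpTo m
      rw [Function.comp_apply, Set.indicator_of_mem hmem, decUpTo_incUpTo, hCD,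
        prod_pow_incUpTo]
      ring
    · simp [decUpTo_incUpTo, hp j hj]
  · intro i hi
    have hmem : i ∉ {i | ValidIdx k i} := fun hv => hi ⟨_, incUpTo_decUpTo m hv⟩
    exact Set.indicator_of_notMem hmem _

/-- The recursion summed against the monomials. -/
lemma LimitRecursion.tauc_mul_pgfFun {k : ℕ} {δ : ℝ} (hδ : -1 < δ)
    {p : (Fin (k + 1) → ℕ) → ℝ} (hp : LimitRecursion k δ p)
    {x : Fin (k + 1) → ℝ} (hx : ∀ ℓ, x ℓ ∈ Set.Ioo (0 : ℝ) 1) {θ : Fin (k + 1) → ℝ}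
    (hθ : ∀ m, HasSum (fun i : Fin (k + 1) → ℕ => (i m : ℝ) * (p i * ∏ ℓ, x ℓ ^ i ℓ)) (θ m)) :
    tauc k δ * pgfFun k p x
      = (∏ ℓ ∈ Finset.univ.filter (· ≤ Fin.last k), x ℓ)
          * (θ (Fin.last k) + δ * pgfFun k p x)
        + (∑ m : Fin k, (∏ ℓ ∈ Finset.univ.filter (· ≤ m.castSucc), x ℓ)
          * (bcoef k δ m * (θ m.castSucc - (k - (m : ℕ)) * pgfFun k p x)
            - bcoef k δ ((m : ℕ) + 1) * (θ m.succ - (k - ((m : ℕ) + 1)) * pgfFun k p x)))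
        - (bcoef k δ 0 * (θ 0 - k * pgfFun k p x) + δ * pgfFun k p x)
        + tauc k δ * ∏ ℓ : Fin (k + 1), x ℓ ^ (k - (ℓ : ℕ) + 1) := by
  have hφ : HasSum (fun i : Fin (k + 1) → ℕ => p i * ∏ ℓ, x ℓ ^ i ℓ) (pgfFun k p x) :=
    (summable_mul_prod_pow (hp.abs_le_one hδ) hx).hasSum
  have hall := hasSum_indicator_transition hp.1 x (Fin.last k)
    (C := fun i => (i (Fin.last k) : ℝ) - 1 + δ) (D := fun j => (j (Fin.last k) : ℝ) + δ)
    (fun j => by simp [incUpTo])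
    (((hθ (Fin.last k)).add (hφ.mul_left δ)).congr_fun fun j => add_mul _ _ _)
  have htrans := hasSum_sum fun (m : Fin k) (_ : m ∈ Finset.univ) =>
    hasSum_indicator_transition hp.1 x m.castSucc
    (C := fun i => ((i m.castSucc : ℝ) - 1 - k + (m : ℕ)) * bcoef k δ (m : ℕ)
            - ((i m.succ : ℝ) - k + (m : ℕ) + 1) * bcoef k δ ((m : ℕ) + 1))
    (D := fun j => ((j m.castSucc : ℝ) - k + (m : ℕ)) * bcoef k δ (m : ℕ)
            - ((j m.succ : ℝ) - k + (m : ℕ) + 1) * bcoef k δ ((m : ℕ) + 1))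
    (fun j => by simp [incUpTo])
    (((((hθ m.castSucc).sub (hφ.mul_left ((k : ℝ) - (m : ℕ)))).mul_left (bcoef k δ m)).sub
      (((hθ m.succ).sub (hφ.mul_left ((k : ℝ) - ((m : ℕ) + 1)))).mul_left
        (bcoef k δ ((m : ℕ) + 1)))).congr_fun fun j => by ring)
  have hout := (((hθ 0).sub (hφ.mul_left (k : ℝ))).mul_left (bcoef k δ 0)).add (hφ.mul_left δ)
  have hinit := (hasSum_ite_eq (fun ℓ : Fin (k + 1) => k - (ℓ : ℕ) + 1)
    (∏ ℓ : Fin (k + 1), x ℓ ^ (k - (ℓ : ℕ) + 1))).mul_left (tauc k δ)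
  refine (hφ.mul_left (tauc k δ)).unique
    ((((hall.add htrans).sub hout).add hinit).congr_fun fun i => ?_)
  by_cases hi : ValidIdx k i
  · have hmem : i ∈ {i | ValidIdx k i} := hi
    simp only [Set.indicator_of_mem hmem]
    rw [← mul_assoc, hp.tauc_mul hδ hi, ← Finset.sum_mul]
    have : (if i = (fun ℓ : Fin (k + 1) => k - (ℓ : ℕ) + 1)
          then ∏ ℓ : Fin (k + 1), x ℓ ^ (k - (ℓ : ℕ) + 1) else 0)
        = (if ∀ ℓ : Fin (k + 1), i ℓ = k - (ℓ : ℕ) + 1 then (1 : ℝ) else 0)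
          * ∏ ℓ, x ℓ ^ i ℓ := by
      by_cases h : ∀ ℓ : Fin (k + 1), i ℓ = k - (ℓ : ℕ) + 1
      · rw [if_pos h, if_pos (funext h), one_mul]
        exact Finset.prod_congr rfl fun ℓ _ => by rw [h ℓ]
      · rw [if_neg h, if_neg fun h' => h fun ℓ => congrFun h' ℓ, zero_mul]
    rw [this]
    simp only [Fin.val_last, Fin.val_castSucc]
    ring
  · have hne : i ≠ fun ℓ : Fin (k + 1) => k - (ℓ : ℕ) + 1 := fun h => hi (h ▸ validIdx_minimal k)
    simp [hi, hp.1 i hi, hne]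

lemma filter_le_succ {k : ℕ} (m : Fin k) :
    Finset.univ.filter (· ≤ m.succ) = insert m.succ (Finset.univ.filter (· ≤ m.castSucc)) := by
  ext ℓ
  simp only [Finset.mem_filter, Finset.mem_univ, true_and, Finset.mem_insert, Fin.le_def,
    Fin.ext_iff, Fin.val_succ, Fin.val_castSucc]
  omega

lemma prod_filter_le_succ {k : ℕ} (x : Fin (k + 1) → ℝ) (m : Fin k) :
    ∏ ℓ ∈ Finset.univ.filter (· ≤ m.succ), x ℓ
      = x m.succ * ∏ ℓ ∈ Finset.univ.filter (· ≤ m.castSucc), x ℓ := by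
  rw [filter_le_succ, Finset.prod_insert]
  simp [Fin.le_def]

lemma prod_filter_le_zero {k : ℕ} (x : Fin (k + 1) → ℝ) :
    ∏ ℓ ∈ Finset.univ.filter (· ≤ (0 : Fin (k + 1))), x ℓ = x 0 := by
  simp [Finset.filter_eq']

/-- The joint probability generating function `φ` of the limiting degree distribution is
differentiable on `(0,1)^{k+1}` and satisfies there the first-order linear PDE
`Σ_m a_m ∂φ/∂x_m = c φ + d` with `a_m(x) = b_m(1-x_m)Π_{ℓ≤m}x_ℓ`,
`c(x) = γ - Σ_m γ_m Π_{ℓ≤m}x_ℓ`, `d(x) = τ Π_ℓ x_ℓ^{k-ℓ+1}`,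
`γ = k²-2+δ(k²-k-2)`, `γ_m = 2(k-m)+δ(2(k-m)-1)`. -/
theorem pgf_satisfies_pde (k : ℕ) (δ : ℝ) (hδ : -1 < δ)
    (p : (Fin (k + 1) → ℕ) → ℝ) (hp : LimitRecursion k δ p)
    (x : Fin (k + 1) → ℝ) (hx : ∀ ℓ, x ℓ ∈ Set.Ioo (0 : ℝ) 1) :
    DifferentiableAt ℝ (pgfFun k p) x ∧
    ∑ m : Fin (k + 1),
        (bcoef k δ (m : ℕ) * (1 - x m) * ∏ ℓ ∈ Finset.univ.filter (· ≤ m), x ℓ)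
          * fderiv ℝ (pgfFun k p) x (Pi.single m 1)
      = ((k : ℝ) ^ 2 - 2 + δ * ((k : ℝ) ^ 2 - k - 2)
          - ∑ m : Fin (k + 1),
              (2 * ((k : ℝ) - (m : ℕ)) + δ * (2 * ((k : ℝ) - (m : ℕ)) - 1))
                * ∏ ℓ ∈ Finset.univ.filter (· ≤ m), x ℓ) * pgfFun k p x
        + tauc k δ * ∏ ℓ : Fin (k + 1), x ℓ ^ (k - (ℓ : ℕ) + 1) := by
  have hp1 := hp.abs_le_one hδ
  refine ⟨(pgfFun_derivative hp1 hx).1.differentiableAt, ?_⟩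
  have hθ := fun m => (summable_coord_mul hp1 hx m).hasSum
  simp only [← mul_fderiv_pgfFun_single hp1 hx] at hθ
  have hrec := hp.tauc_mul_pgfFun hδ hx hθ
  set φ := pgfFun k p x
  set D := fun m => fderiv ℝ (pgfFun k p) x (Pi.single m 1)
  set y := fun m : Fin (k + 1) => ∏ ℓ ∈ Finset.univ.filter (· ≤ m), x ℓ
  have hy0 : y 0 = x 0 := prod_filter_le_zero x
  have hys : ∀ m : Fin k, y m.succ = x m.succ * y m.castSucc := prod_filter_le_succ x
  have hL : ∑ m : Fin (k + 1), (bcoef k δ (m : ℕ) * (1 - x m) * y m) * D m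
      = bcoef k δ 0 * x 0 * D 0
        + ∑ m : Fin k, bcoef k δ ((m : ℕ) + 1) * (x m.succ * D m.succ) * y m.castSucc
        - (∑ m : Fin k, bcoef k δ m * (x m.castSucc * D m.castSucc) * y m.castSucc
          + x (Fin.last k) * D (Fin.last k) * y (Fin.last k)) := by
    have hbk : bcoef k δ k = 1 := by simp [bcoef]
    have h1 := Fin.sum_univ_succ fun m : Fin (k + 1) => bcoef k δ (m : ℕ) * y m * D m
    have h2 := Fin.sum_univ_castSucc
      fun m : Fin (k + 1) => bcoef k δ (m : ℕ) * (x m * D m) * y m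
    simp only [Fin.val_castSucc, Fin.val_last, hbk, one_mul] at h2
    simp only [Fin.val_succ, Fin.val_zero, hy0, hys] at h1
    rw [← h2]
    have h3 : ∑ m : Fin k, bcoef k δ ((m : ℕ) + 1) * (x m.succ * D m.succ) * y m.castSucc
        = ∑ m : Fin k, bcoef k δ ((m : ℕ) + 1) * (x m.succ * y m.castSucc) * D m.succ :=
      Finset.sum_congr rfl fun m _ => by ring
    rw [h3, ← h1, ← Finset.sum_sub_distrib]
    exact Finset.sum_congr rfl fun m _ => by ring
  have hγ := Fin.sum_univ_castSucc fun m : Fin (k + 1) =>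
    (2 * ((k : ℝ) - (m : ℕ)) + δ * (2 * ((k : ℝ) - (m : ℕ)) - 1)) * y m
  simp only [Fin.val_castSucc, Fin.val_last] at hγ
  have hS : ∑ m : Fin k, y m.castSucc
          * (bcoef k δ m * (x m.castSucc * D m.castSucc - (k - (m : ℕ)) * φ)
            - bcoef k δ ((m : ℕ) + 1) * (x m.succ * D m.succ - (k - ((m : ℕ) + 1)) * φ))
      = ∑ m : Fin k, bcoef k δ m * (x m.castSucc * D m.castSucc) * y m.castSucc
        - ∑ m : Fin k, bcoef k δ ((m : ℕ) + 1) * (x m.succ * D m.succ) * y m.castSucc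
        - (∑ m : Fin k, (2 * ((k : ℝ) - (m : ℕ)) + δ * (2 * ((k : ℝ) - (m : ℕ)) - 1))
          * y m.castSucc) * φ := by
    rw [Finset.sum_mul, ← Finset.sum_sub_distrib, ← Finset.sum_sub_distrib]
    refine Finset.sum_congr rfl fun m _ => ?_
    unfold bcoef
    push_cast
    ring
  rw [hL, hγ]
  rw [hS] at hrec
  have hb0 : bcoef k δ 0 = k + 1 + δ * k := by simp [bcoef]
  have hτ : tauc k δ * φ = ((k : ℝ) + 2 + δ * (k + 1)) * φ := rfl
  rw [hb0] at hrec ⊢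
  linear_combination hrec - hτ
end
end
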